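/- Let f be a non-constant meromorphic function on ℂ and let P[f] be a differential polynomial generated by f of order k with small-function coefficients. Then N(r,∞; P[f]/f^{d̄(P)}) ≤ (Γ_P − d̄(P))·N̄(r,∞;f) + (d̄(P) − d̲(P))·N(r,0;f|≥k+1) + μ·N̄(r,0;f|≥k+1) + d̄(P)·N(r,0;f|≤k) + S(r,f). -/

import Mathlib

open MeasureTheory Filter Set

noncomputable section

open Classical in

/-- The order of the (meromorphic-type) function `f` at the point `z₀`: the unique integer `n`
such that `f z = (z - z₀) ^ n * g z` near `z₀` with `g` analytic and nonvanishing at `z₀`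
(junk value `0` if no such `n` exists). -/
def merOrd (f : ℂ → ℂ) (z₀ : ℂ) : ℤ :=
  if h : ∃ n : ℤ, ∃ g : ℂ → ℂ, AnalyticAt ℂ g z₀ ∧ g z₀ ≠ 0 ∧
      ∀ᶠ z in nhdsWithin z₀ {z₀}ᶜ, f z = (z - z₀) ^ n * g z
  then h.choose else 0

/-- The unintegrated counting function `n(t)` attached to an integer weight `w` on `ℂ`. -/
def preCount (w : ℂ → ℤ) (t : ℝ) : ℝ := ∑ᶠ z ∈ {z : ℂ | ‖z‖ ≤ t}, ((w z : ℤ) : ℝ)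

/-- The integrated Nevanlinna counting function
`N(r) = ∫₀^r (n(t) - n(0))/t dt + n(0) log r` attached to an integer weight `w`. -/
def intCount (w : ℂ → ℤ) (r : ℝ) : ℝ :=
  (∫ t in (0:ℝ)..r, (preCount w t - preCount w 0) / t) + preCount w 0 * Real.log r

/-- `N(r,∞;f)`: integrated counting function of the poles of `f`. -/
def Npoles (f : ℂ → ℂ) : ℝ → ℝ := intCount fun z => max (-(merOrd f z)) 0

/-- `N̄(r,∞;f)`: reduced integrated counting function of the poles of `f`. -/
def NbarPoles (f : ℂ → ℂ) : ℝ → ℝ := intCount fun z => if merOrd f z < 0 then 1 else 0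

/-- `N(r,0;f)`: integrated counting function of the zeros of `f`. -/
def Nzeros (f : ℂ → ℂ) : ℝ → ℝ := intCount fun z => max (merOrd f z) 0

/-- `N̄(r,0;f)`: reduced integrated counting function of the zeros of `f`. -/
def NbarZeros (f : ℂ → ℂ) : ℝ → ℝ := intCount fun z => if 0 < merOrd f z then 1 else 0

/-- `N(r,0;f∣≤p)`: counting function of the zeros of `f` of multiplicity at most `p`. -/
def NzerosLe (p : ℤ) (f : ℂ → ℂ) : ℝ → ℝ :=
  intCount fun z => if 0 < merOrd f z ∧ merOrd f z ≤ p then merOrd f z else 0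

/-- `N(r,0;f∣≥p)`: counting function of the zeros of `f` of multiplicity at least `p`. -/
def NzerosGe (p : ℤ) (f : ℂ → ℂ) : ℝ → ℝ :=
  intCount fun z => if 0 < merOrd f z ∧ p ≤ merOrd f z then merOrd f z else 0

/-- `N̄(r,0;f∣≥p)`: reduced counting function of the zeros of `f` of multiplicity at least `p`. -/
def NbarZerosGe (p : ℤ) (f : ℂ → ℂ) : ℝ → ℝ :=
  intCount fun z => if 0 < merOrd f z ∧ p ≤ merOrd f z then 1 else 0

/-- `N_2(r,0;f) = N̄(r,0;f) + N̄(r,0;f∣≥2)`. -/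
def N2zeros (f : ℂ → ℂ) (r : ℝ) : ℝ := NbarZeros f r + NbarZerosGe 2 f r

/-- The Nevanlinna proximity function `m(r,f)`. -/
def prox (f : ℂ → ℂ) (r : ℝ) : ℝ :=
  (2 * Real.pi)⁻¹ * ∫ θ in (0:ℝ)..(2 * Real.pi),
    max (Real.log ‖f ((r : ℂ) * Complex.exp ((θ : ℂ) * Complex.I))‖) 0

/-- The Nevanlinna characteristic function `T(r,f) = m(r,f) + N(r,∞;f)`. -/
def nevT (f : ℂ → ℂ) (r : ℝ) : ℝ := prox f r + Npoles f r

/-- `S` is a quantity `S(r,f)`, i.e. `S(r) = o(T(r,f))` as `r → ∞` outside a possible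
exceptional set `E` of finite linear measure. -/
def IsSmallWrt (S : ℝ → ℝ) (f : ℂ → ℂ) : Prop :=
  ∃ E : Set ℝ, volume E < ⊤ ∧
    Tendsto (fun r => S r / nevT f r) (atTop ⊓ 𝓟 Eᶜ) (nhds 0)

/-- `a` is a small function of `f`: `a` is meromorphic (`a ≢ ∞`) and `T(r,a) = S(r,f)`. -/
def SmallFn (a f : ℂ → ℂ) : Prop :=
  MeromorphicOn a Set.univ ∧ IsSmallWrt (nevT a) f

/-- A meromorphic-type function is non-constant (it does not agree with a constant off a
countable set). -/
def NonConst (f : ℂ → ℂ) : Prop := ∀ c : ℂ, ¬ {z | f z ≠ c}.Countable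

/-- `f ≢ 0` for a meromorphic-type function `f`. -/
def NotIdZero (f : ℂ → ℂ) : Prop := ¬ {z | f z ≠ 0}.Countable

/-- `Ē_{m)}(a;g)`: the set of distinct zeros of `g - a` of multiplicity at most `m`
(`m` a positive integer or `∞`). -/
def EbarSet (m : ℕ∞) (a g : ℂ → ℂ) : Set ℂ :=
  {z | 0 < merOrd (fun w => g w - a w) z ∧
       ((merOrd (fun w => g w - a w) z).toNat : ℕ∞) ≤ m}

/-- A differential polynomial `P[f] = ∑_{j} b_j ∏_{i ≤ k} (f^{(i)})^{n_{ij}}` of order `k`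
with `t` monomials: `coeff j = b_j` and `expo j i = n_{ij}`. -/
structure DiffPoly (k t : ℕ) where
  coeff : Fin t → ℂ → ℂ
  expo : Fin t → Fin (k + 1) → ℕ

namespace DiffPoly

variable {k t : ℕ}

/-- Evaluation `P[f]` of a differential polynomial on `f`. -/
def eval (P : DiffPoly k t) (f : ℂ → ℂ) : ℂ → ℂ := fun z =>
  ∑ j, P.coeff j z * ∏ i, iteratedDeriv i.val f z ^ P.expo j i

/-- The degree `d(M_j)` of the `j`-th monomial. -/
def monDeg (P : DiffPoly k t) (j : Fin t) : ℕ := ∑ i, P.expo j i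

/-- The weight `Γ_{M_j}` of the `j`-th monomial. -/
def monWt (P : DiffPoly k t) (j : Fin t) : ℕ := ∑ i, (i.val + 1) * P.expo j i

/-- The degree `d̄(P) = max_j d(M_j)`. -/
def degU (P : DiffPoly k t) : ℕ := Finset.univ.sup fun j => P.monDeg j

/-- The lower degree `d̲(P) = min_j d(M_j)`. -/
def degL (P : DiffPoly k t) : ℕ := sInf (Set.range fun j => P.monDeg j)

/-- The weight `Γ_P = max_j Γ_{M_j}`. -/
def wt (P : DiffPoly k t) : ℕ := Finset.univ.sup fun j => P.monWt j

/-- `μ = max_j (Γ_{M_j} - d(M_j))`. -/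
def mu (P : DiffPoly k t) : ℕ := Finset.univ.sup fun j => P.monWt j - P.monDeg j

/-- All coefficients of `P` are small functions of `f`. -/
def SmallCoeffs (P : DiffPoly k t) (f : ℂ → ℂ) : Prop := ∀ j, SmallFn (P.coeff j) f

/-- `P` contains at least one derivative of `f`. -/
def HasDerivTerm (P : DiffPoly k t) : Prop := ∃ j i, 1 ≤ i.val ∧ 0 < P.expo j i

end DiffPoly


/-- The kernel of the counting function attached to one point. -/
def ker1 (z : ℂ) (r : ℝ) : ℝ :=
  (∫ t in (0:ℝ)..r, ((if ‖z‖ ≤ t then (1:ℝ) else 0) - (if ‖z‖ ≤ 0 then (1:ℝ) else 0)) / t)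
    + (if ‖z‖ ≤ 0 then (1:ℝ) else 0) * Real.log r

lemma ker1_nonneg (z : ℂ) {r : ℝ} (hr : 1 ≤ r) : 0 ≤ ker1 z r := by
  unfold ker1
  have hl := Real.log_nonneg hr
  apply add_nonneg
  · apply intervalIntegral.integral_nonneg (by linarith)
    intro t ht
    apply div_nonneg _ ht.1
    split_ifs with h1 h2 h2
    · simp
    · simp
    · exact absurd (h2.trans ht.1) h1
    · simp
  · split_ifs <;> simp [hl]

lemma preCount_eq (w : ℂ → ℤ) {r t : ℝ} (htr : t ≤ r) (F : Finset ℂ)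
    (hF : ∀ z : ℂ, ‖z‖ ≤ r → w z ≠ 0 → z ∈ F) :
    preCount w t = ∑ z ∈ F, (w z : ℝ) * (if ‖z‖ ≤ t then (1:ℝ) else 0) := by
  classical
  unfold preCount
  rw [finsum_mem_def, finsum_eq_sum_of_support_subset (s := F)]
  · apply Finset.sum_congr rfl
    intro z _
    simp [Set.indicator_apply]
  · intro z hz
    simp only [Function.mem_support, Set.indicator_apply_ne_zero] at hz
    have h1 : ‖z‖ ≤ t := hz.1
    have h2 : ((w z : ℤ) : ℝ) ≠ 0 := hz.2
    exact hF z (h1.trans htr) (by exact_mod_cast h2)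

lemma ker1_integrable (z : ℂ) (r : ℝ) (hr : 0 ≤ r) :
    IntervalIntegrable (fun t : ℝ => ((if ‖z‖ ≤ t then (1:ℝ) else 0)
      - (if ‖z‖ ≤ 0 then (1:ℝ) else 0)) / t) volume 0 r := by
  by_cases hz : z = 0
  · rw [intervalIntegrable_iff_integrableOn_Ioc_of_le hr]
    refine IntegrableOn.congr_fun (f := fun _ => (0:ℝ)) (integrable_zero _ _ _) ?_ measurableSet_Ioc
    intro t ht
    simp [hz, ht.1.le]
  · have hz' : 0 < ‖z‖ := norm_pos_iff.2 hz
    rw [intervalIntegrable_iff_integrableOn_Ioc_of_le hr]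
    refine Measure.integrableOn_of_bounded (M := ‖z‖⁻¹) (by simp) ?_ ?_
    · apply Measurable.aestronglyMeasurable
      apply Measurable.div _ measurable_id
      apply Measurable.sub_const
      exact Measurable.ite measurableSet_Ici measurable_const measurable_const
    · refine Eventually.of_forall fun t => ?_
      have h0 : ¬ ‖z‖ ≤ 0 := not_le.2 hz'
      simp only [h0, if_false, sub_zero]
      split_ifs with h
      · have : 0 < t := hz'.trans_le h
        rw [Real.norm_eq_abs, abs_of_pos (by positivity), one_div]
        exact inv_anti₀ hz' h
      · simp

lemma intCount_eq (w : ℂ → ℤ) {r : ℝ} (hr : 0 ≤ r) (F : Finset ℂ)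
    (hF : ∀ z : ℂ, ‖z‖ ≤ r → w z ≠ 0 → z ∈ F) :
    intCount w r = ∑ z ∈ F, (w z : ℝ) * ker1 z r := by
  unfold intCount
  have h1 : ∫ t in (0:ℝ)..r, (preCount w t - preCount w 0) / t
      = ∫ t in (0:ℝ)..r, ∑ z ∈ F, (w z : ℝ) * (((if ‖z‖ ≤ t then (1:ℝ) else 0)
      - (if ‖z‖ ≤ 0 then (1:ℝ) else 0)) / t) := by
    apply intervalIntegral.integral_congr
    intro t ht
    rw [uIcc_of_le hr] at ht
    simp only
    rw [preCount_eq w ht.2 F hF, preCount_eq w hr F hF, ← Finset.sum_sub_distrib, Finset.sum_div]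
    apply Finset.sum_congr rfl
    intro z _
    ring
  rw [h1, intervalIntegral.integral_finsetSum, preCount_eq w hr F hF, Finset.sum_mul,
    ← Finset.sum_add_distrib]
  · apply Finset.sum_congr rfl
    intro z _
    rw [intervalIntegral.integral_const_mul, ker1]
    ring
  · intro z _
    exact (ker1_integrable z r hr).const_mul _

lemma merOrd_eq {f : ℂ → ℂ} {x : ℂ} (hf : MeromorphicAt f x) :
    merOrd f x = (meromorphicOrderAt f x).untop₀ := by
  have key : ∀ n : ℤ, meromorphicOrderAt f x = n ↔ ∃ g : ℂ → ℂ, AnalyticAt ℂ g x ∧ g x ≠ 0 ∧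
      ∀ᶠ z in nhdsWithin x {x}ᶜ, f z = (z - x) ^ n * g z := by
    intro n
    simpa using meromorphicOrderAt_eq_int_iff (n := n) hf
  unfold merOrd
  split_ifs with h
  · rw [(key _).2 h.choose_spec]
    simp
  · cases h' : meromorphicOrderAt f x with
    | top => simp
    | coe n => exact absurd ⟨n, (key n).1 h'⟩ h

lemma merOrd_finite {f : ℂ → ℂ} (hf : MeromorphicOn f Set.univ) (r : ℝ) :
    {z : ℂ | ‖z‖ ≤ r ∧ merOrd f z ≠ 0}.Finite := by
  have hU : MeromorphicOn f (Metric.closedBall 0 r) := fun z _ => hf z (mem_univ z)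
  refine ((MeromorphicOn.divisor f (Metric.closedBall 0 r)).finiteSupport
    (isCompact_closedBall 0 r)).subset ?_
  rintro z ⟨hz, hne⟩
  have hzb : z ∈ Metric.closedBall (0:ℂ) r := by simpa using hz
  rw [Function.mem_support, MeromorphicOn.divisor_apply hU hzb, ← merOrd_eq (hf z (mem_univ z))]
  exact hne

/-- `f` is meromorphic at `x` and has order at least `n` there. -/
def OrdGe (f : ℂ → ℂ) (x : ℂ) (n : ℤ) : Prop :=
  MeromorphicAt f x ∧ (n : WithTop ℤ) ≤ meromorphicOrderAt f x

lemma OrdGe.mono {f : ℂ → ℂ} {x : ℂ} {n m : ℤ} (h : OrdGe f x n) (hm : m ≤ n) : OrdGe f x m :=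
  ⟨h.1, le_trans (by exact_mod_cast hm) h.2⟩

lemma OrdGe.mul {f g : ℂ → ℂ} {x : ℂ} {n m : ℤ} (hf : OrdGe f x n) (hg : OrdGe g x m) :
    OrdGe (fun z => f z * g z) x (n + m) := by
  refine ⟨hf.1.mul hg.1, ?_⟩
  have h := meromorphicOrderAt_mul hf.1 hg.1
  change _ ≤ meromorphicOrderAt (f * g) x
  rw [h]
  push_cast
  exact add_le_add hf.2 hg.2

lemma OrdGe.one (x : ℂ) : OrdGe (fun _ => 1) x 0 :=
  ⟨MeromorphicAt.const 1 x, (analyticAt_const).meromorphicOrderAt_nonneg⟩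

lemma OrdGe.zero (x : ℂ) (n : ℤ) : OrdGe (fun _ => 0) x n :=
  by
  refine ⟨MeromorphicAt.const 0 x, ?_⟩
  have : meromorphicOrderAt (fun _ : ℂ => (0:ℂ)) x = ⊤ :=
    meromorphicOrderAt_eq_top_iff.2 (Eventually.of_forall fun _ => rfl)
  rw [this]
  exact le_top

lemma OrdGe.add {f g : ℂ → ℂ} {x : ℂ} {n : ℤ} (hf : OrdGe f x n) (hg : OrdGe g x n) :
    OrdGe (fun z => f z + g z) x n :=
  ⟨hf.1.add hg.1, le_trans (le_min hf.2 hg.2) (meromorphicOrderAt_add hf.1 hg.1)⟩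

lemma OrdGe.sum {ι : Type*} (s : Finset ι) {f : ι → ℂ → ℂ} {x : ℂ} {n : ℤ}
    (hf : ∀ i ∈ s, OrdGe (f i) x n) : OrdGe (fun z => ∑ i ∈ s, f i z) x n := by
  classical
  induction s using Finset.induction with
  | empty => simpa using OrdGe.zero x n
  | insert a s ha ih =>
    simp only [Finset.sum_insert ha]
    exact (hf a (by simp)).add (ih fun i hi => hf i (by simp [hi]))

lemma OrdGe.prod {ι : Type*} (s : Finset ι) {f : ι → ℂ → ℂ} {x : ℂ} {n : ι → ℤ}
    (hf : ∀ i ∈ s, OrdGe (f i) x (n i)) :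
    OrdGe (fun z => ∏ i ∈ s, f i z) x (∑ i ∈ s, n i) := by
  classical
  induction s using Finset.induction with
  | empty => simpa using OrdGe.one x
  | insert a s ha ih =>
    simp only [Finset.prod_insert ha, Finset.sum_insert ha]
    exact (hf a (by simp)).mul (ih fun i hi => hf i (by simp [hi]))

lemma OrdGe.pow {f : ℂ → ℂ} {x : ℂ} {n : ℤ} (hf : OrdGe f x n) (e : ℕ) :
    OrdGe (fun z => f z ^ e) x (e * n) := by
  have := OrdGe.prod (Finset.range e) (f := fun _ => f) (n := fun _ => n) fun _ _ => hf
  simpa using this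

lemma OrdGe.deriv_zero {f : ℂ → ℂ} {x : ℂ} (hf : OrdGe f x 0) : OrdGe (deriv f) x 0 := by
  refine ⟨hf.1.deriv, ?_⟩
  obtain ⟨g, hg, hfg⟩ := (hf.1.meromorphicOrderAt_nonneg_iff).1 (by simpa using hf.2)
  have := (hf.1.deriv.meromorphicOrderAt_nonneg_iff).2 ⟨deriv g, hg.deriv, hfg.nhdsNE_deriv⟩
  simpa using this

lemma OrdGe.deriv_sub {f : ℂ → ℂ} {x : ℂ} {n : ℤ} (hf : OrdGe f x n) :
    OrdGe (deriv f) x (n - 1) := by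
  refine ⟨hf.1.deriv, ?_⟩
  cases h : meromorphicOrderAt f x with
  | top =>
    have h1 : f =ᶠ[nhdsWithin x {x}ᶜ] (fun _ => 0) := meromorphicOrderAt_eq_top_iff.1 h
    have h2 : meromorphicOrderAt (deriv f) x = ⊤ := by
      rw [meromorphicOrderAt_eq_top_iff]
      filter_upwards [h1.nhdsNE_deriv] with z hz
      simpa using hz
    rw [h2]
    exact le_top
  | coe m =>
    have hnm : n ≤ m := by
      have := hf.2
      rw [h] at this
      exact_mod_cast this
    by_cases hm : m = 0
    · subst hm
      have h0 : OrdGe (deriv f) x 0 := OrdGe.deriv_zero ⟨hf.1, by simp [h]⟩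
      exact (h0.mono (by omega)).2
    · rw [meromorphicOrderAt_deriv_eq_sub_one (by exact_mod_cast hm) h]
      exact_mod_cast (by omega : n - 1 ≤ m - 1)

lemma OrdGe.iter_sub {f : ℂ → ℂ} {x : ℂ} {n : ℤ} (hf : OrdGe f x n) (i : ℕ) :
    OrdGe (iteratedDeriv i f) x (n - i) := by
  induction i with
  | zero => simpa [iteratedDeriv_zero] using hf
  | succ i ih =>
    rw [iteratedDeriv_succ]
    exact ih.deriv_sub.mono (by push_cast; omega)

lemma OrdGe.iter_zero {f : ℂ → ℂ} {x : ℂ} (hf : OrdGe f x 0) (i : ℕ) :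
    OrdGe (iteratedDeriv i f) x 0 := by
  induction i with
  | zero => simpa [iteratedDeriv_zero] using hf
  | succ i ih =>
    rw [iteratedDeriv_succ]
    exact ih.deriv_zero

lemma OrdGe.of_merOrd {f : ℂ → ℂ} {x : ℂ} (hf : MeromorphicAt f x) : OrdGe f x (merOrd f x) := by
  refine ⟨hf, ?_⟩
  rw [merOrd_eq hf]
  cases h : meromorphicOrderAt f x with
  | top => simp
  | coe n => simp

lemma OrdGe.inv_of_merOrd {f : ℂ → ℂ} {x : ℂ} (hf : MeromorphicAt f x)
    (h : meromorphicOrderAt f x ≠ ⊤) : OrdGe (fun z => (f z)⁻¹) x (-merOrd f x) := by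
  refine ⟨hf.inv, ?_⟩
  change _ ≤ meromorphicOrderAt (f⁻¹) x
  rw [meromorphicOrderAt_inv, merOrd_eq hf]
  lift meromorphicOrderAt f x to ℤ using h with n
  simp

lemma OrdGe.pole_le {f : ℂ → ℂ} {x : ℂ} {m : ℤ} (h : OrdGe f x (-m)) (hm : 0 ≤ m) :
    max (-(merOrd f x)) 0 ≤ m := by
  refine max_le ?_ hm
  have h2 := h.2
  rw [merOrd_eq h.1]
  cases h' : meromorphicOrderAt f x with
  | top => simpa using hm
  | coe n =>
    rw [h'] at h2
    have : -m ≤ n := by exact_mod_cast h2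
    simp only [WithTop.untop₀_coe]
    omega

lemma order_ne_top {f : ℂ → ℂ} (hf : MeromorphicOn f Set.univ) (hfnc : NonConst f) (x : ℂ) :
    meromorphicOrderAt f x ≠ ⊤ := by
  intro hx
  apply hfnc 0
  have hall : ∀ y : ℂ, meromorphicOrderAt f y = ⊤ := by
    intro y
    by_contra hy
    exact hf.meromorphicOrderAt_ne_top_of_isPreconnected isPreconnected_univ (mem_univ y)
      (mem_univ x) hy hx
  have hc : ∀ y ∈ {z : ℂ | f z ≠ 0}, ({y} : Set ℂ) ∈ nhdsWithin y {z : ℂ | f z ≠ 0} := by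
    intro y _
    have h1 := meromorphicOrderAt_eq_top_iff.1 (hall y)
    rw [eventually_nhdsWithin_iff] at h1
    rw [mem_nhdsWithin_iff_eventually]
    filter_upwards [h1] with z hz hz'
    by_contra hne
    exact hz' (hz hne)
  obtain ⟨t, -, htc, hst⟩ := TopologicalSpace.countable_cover_nhdsWithin hc
  refine htc.mono fun z hz => ?_
  simpa using hst hz

lemma quot_eq {k t : ℕ} (P : DiffPoly k t) (f : ℂ → ℂ) :
    (fun z => P.eval f z / f z ^ P.degU) = fun z => ∑ j, (P.coeff j z *
      ∏ i, iteratedDeriv i.val f z ^ P.expo j i) * ((f z)⁻¹) ^ P.degU := by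
  funext z
  rw [DiffPoly.eval, div_eq_mul_inv, Finset.sum_mul, inv_pow]

lemma monDeg_le_monWt {k t : ℕ} (P : DiffPoly k t) (j : Fin t) : P.monDeg j ≤ P.monWt j := by
  unfold DiffPoly.monDeg DiffPoly.monWt
  exact Finset.sum_le_sum fun i _ => Nat.le_mul_of_pos_left _ (by omega)

lemma exp_sum {k t : ℕ} (P : DiffPoly k t) (j : Fin t) (n : ℤ) :
    ∑ i : Fin (k + 1), (P.expo j i : ℤ) * (n - (i.val : ℤ))
      = n * P.monDeg j - (P.monWt j - P.monDeg j) := by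
  unfold DiffPoly.monDeg DiffPoly.monWt
  push_cast
  rw [Finset.mul_sum, ← Finset.sum_sub_distrib, ← Finset.sum_sub_distrib]
  apply Finset.sum_congr rfl
  intro i _
  ring

/-- The order bound for one term of `P[f] / f ^ d`. -/
lemma term_ord {k t : ℕ} (P : DiffPoly k t) {f : ℂ → ℂ} {x : ℂ} (hf : MeromorphicAt f x)
    (hft : meromorphicOrderAt f x ≠ ⊤) (hb : ∀ j, MeromorphicAt (P.coeff j) x) (j : Fin t)
    (l : Fin (k + 1) → ℤ) (hl : ∀ i, OrdGe (iteratedDeriv i.val f) x (l i)) :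
    OrdGe (fun z => (P.coeff j z * ∏ i, iteratedDeriv i.val f z ^ P.expo j i)
      * ((f z)⁻¹) ^ P.degU) x
      (merOrd (P.coeff j) x + ∑ i, (P.expo j i : ℤ) * l i + (P.degU : ℤ) * (-merOrd f x)) :=
  ((OrdGe.of_merOrd (hb j)).mul (OrdGe.prod _ fun i _ => (hl i).pow _)).mul
    ((OrdGe.inv_of_merOrd hf hft).pow _)

/-- The weight inequality at a point. -/
lemma pointwise {k t : ℕ} (P : DiffPoly k t) {f : ℂ → ℂ} {x : ℂ} (hf : MeromorphicAt f x)
    (hft : meromorphicOrderAt f x ≠ ⊤) (hb : ∀ j, MeromorphicAt (P.coeff j) x) (ht : 0 < t) :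
    max (-(merOrd (fun z => P.eval f z / f z ^ P.degU) x)) 0 ≤
      ((P.wt : ℤ) - P.degU) * (if merOrd f x < 0 then 1 else 0)
      + ((P.degU : ℤ) - P.degL)
        * (if 0 < merOrd f x ∧ (k : ℤ) + 1 ≤ merOrd f x then merOrd f x else 0)
      + (P.mu : ℤ) * (if 0 < merOrd f x ∧ (k : ℤ) + 1 ≤ merOrd f x then 1 else 0)
      + (P.degU : ℤ) * (if 0 < merOrd f x ∧ merOrd f x ≤ (k : ℤ) then merOrd f x else 0)
      + ∑ j, max (-(merOrd (P.coeff j) x)) 0 := by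
  have hU : ∀ j, P.monDeg j ≤ P.degU := fun j =>
    Finset.le_sup (f := fun j => P.monDeg j) (Finset.mem_univ j)
  have hW : ∀ j, P.monWt j ≤ P.wt := fun j =>
    Finset.le_sup (f := fun j => P.monWt j) (Finset.mem_univ j)
  have hM : ∀ j, P.monWt j - P.monDeg j ≤ P.mu := fun j =>
    Finset.le_sup (f := fun j => P.monWt j - P.monDeg j) (Finset.mem_univ j)
  have hL : ∀ j, P.degL ≤ P.monDeg j := fun j => Nat.sInf_le ⟨j, rfl⟩
  have hUW : P.degU ≤ P.wt := Finset.sup_le fun j _ => (monDeg_le_monWt P j).trans (hW j)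
  have hLU : P.degL ≤ P.degU := (hL ⟨0, ht⟩).trans (hU ⟨0, ht⟩)
  have hc : ∀ j, -(merOrd (P.coeff j) x) ≤ ∑ j, max (-(merOrd (P.coeff j) x)) 0 := fun j =>
    (le_max_left _ 0).trans (Finset.single_le_sum
      (f := fun j => max (-(merOrd (P.coeff j) x)) 0) (fun i _ => le_max_right _ _)
      (Finset.mem_univ j))
  have hc0 : 0 ≤ ∑ j, max (-(merOrd (P.coeff j) x)) 0 :=
    Finset.sum_nonneg fun i _ => le_max_right _ _
  have hord := OrdGe.of_merOrd hf
  have hterm := term_ord P hf hft hb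
  generalize (∑ j, max (-(merOrd (P.coeff j) x)) 0) = C at *
  generalize merOrd f x = n at *
  rw [quot_eq]
  zify at hU hW hL hUW hLU
  have hmain : ∀ m : ℤ, 0 ≤ m → (∀ j, ∃ l : Fin (k + 1) → ℤ,
      (∀ i, OrdGe (iteratedDeriv i.val f) x (l i)) ∧
      (P.degU : ℤ) * n - ∑ i, (P.expo j i : ℤ) * l i ≤ m) →
      max (-(merOrd (fun z => ∑ j, (P.coeff j z *
        ∏ i, iteratedDeriv i.val f z ^ P.expo j i) * ((f z)⁻¹) ^ P.degU) x)) 0 ≤ m + C := by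
    intro m hm h
    refine OrdGe.pole_le (OrdGe.sum _ fun j _ => ?_) (by omega)
    obtain ⟨l, hl, hle⟩ := h j
    refine (hterm j l hl).mono ?_
    have := hc j
    rw [mul_neg]
    linarith
  refine hmain _ ?_ ?_
  · have h1 : (0:ℤ) ≤ (P.wt : ℤ) - P.degU := by omega
    have h2 : (0:ℤ) ≤ (P.degU : ℤ) - P.degL := by omega
    have h3 : (0:ℤ) ≤ (if 0 < n ∧ (k : ℤ) + 1 ≤ n then n else 0) := by split_ifs <;> omega
    have h4 : (0:ℤ) ≤ (if 0 < n ∧ n ≤ (k : ℤ) then n else 0) := by split_ifs <;> omega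
    have h5 : (0:ℤ) ≤ (if 0 < n ∧ (k : ℤ) + 1 ≤ n then 1 else 0) := by split_ifs <;> omega
    have h6 : (0:ℤ) ≤ (if n < 0 then 1 else 0) := by split_ifs <;> omega
    positivity
  · intro j
    have hdw := monDeg_le_monWt P j
    have hMj := hM j
    have hMj' : (P.monWt j : ℤ) - P.monDeg j ≤ P.mu := by omega
    by_cases h0 : n < 0
    · refine ⟨fun i => n - i.val, fun i => hord.iter_sub _, ?_⟩
      rw [exp_sum]
      have e1 : ¬ (0 < n ∧ (k : ℤ) + 1 ≤ n) := by omega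
      have e2 : ¬ (0 < n ∧ n ≤ (k : ℤ)) := by omega
      rw [if_pos h0, if_neg e1, if_neg e1, if_neg e2]
      nlinarith [hU j, hW j, mul_nonneg (sub_nonneg.2 (hU j)) (by omega : 0 ≤ -n - 1)]
    · by_cases h1 : (k : ℤ) + 1 ≤ n
      · refine ⟨fun i => n - i.val, fun i => hord.iter_sub _, ?_⟩
        rw [exp_sum]
        have e1 : (0 < n ∧ (k : ℤ) + 1 ≤ n) := by omega
        have e2 : ¬ (0 < n ∧ n ≤ (k : ℤ)) := by omega
        rw [if_neg h0, if_pos e1, if_pos e1, if_neg e2]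
        nlinarith [hL j, mul_nonneg (sub_nonneg.2 (hL j)) (by omega : 0 ≤ n)]
      · refine ⟨fun i => 0, fun i => (hord.mono (by omega)).iter_zero _, ?_⟩
        have e1 : ¬ (0 < n ∧ (k : ℤ) + 1 ≤ n) := by omega
        by_cases h2 : n = 0
        · simp [h2]
        · have e2 : (0 < n ∧ n ≤ (k : ℤ)) := by omega
          rw [if_neg h0, if_neg e1, if_neg e1, if_pos e2]
          simp

lemma prox_nonneg (f : ℂ → ℂ) (r : ℝ) : 0 ≤ prox f r := by
  unfold prox
  apply mul_nonneg (by positivity)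
  exact intervalIntegral.integral_nonneg (by positivity) fun _ _ => le_max_right _ _

lemma Npoles_nonneg {f : ℂ → ℂ} (hf : MeromorphicOn f Set.univ) {r : ℝ} (hr : 1 ≤ r) :
    0 ≤ Npoles f r := by
  unfold Npoles
  rw [intCount_eq _ (by linarith) (merOrd_finite hf r).toFinset]
  · refine Finset.sum_nonneg fun z _ => mul_nonneg ?_ (ker1_nonneg z hr)
    exact_mod_cast le_max_right _ _
  · intro z hz hne
    simp only [Set.Finite.mem_toFinset, mem_ofPred_eq]
    refine ⟨hz, fun h => hne ?_⟩
    simp [h]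

lemma counting_bound {k t : ℕ} (P : DiffPoly k t) {f : ℂ → ℂ} (hf : MeromorphicOn f Set.univ)
    (hfnc : NonConst f) (hb : ∀ j, MeromorphicOn (P.coeff j) Set.univ) (ht : 0 < t)
    {r : ℝ} (hr : 1 ≤ r) :
    Npoles (fun z => P.eval f z / f z ^ P.degU) r ≤
        ((P.wt : ℝ) - (P.degU : ℝ)) * NbarPoles f r
        + ((P.degU : ℝ) - (P.degL : ℝ)) * NzerosGe ((k : ℤ) + 1) f r
        + (P.mu : ℝ) * NbarZerosGe ((k : ℤ) + 1) f r
        + (P.degU : ℝ) * NzerosLe (k : ℤ) f r + ∑ j, Npoles (P.coeff j) r := by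
  classical
  have hQ : MeromorphicOn (fun z => P.eval f z / f z ^ P.degU) Set.univ := by
    intro z _
    have hfz := hf z (mem_univ z)
    rw [quot_eq]
    have hdz : ∀ i : ℕ, MeromorphicAt (iteratedDeriv i f) z := fun i =>
      ((OrdGe.of_merOrd hfz).iter_sub i).1
    have hbz : ∀ j, MeromorphicAt (P.coeff j) z := fun j => hb j z (mem_univ z)
    have hft := order_ne_top hf hfnc z
    refine MeromorphicAt.fun_sum fun j _ => ?_
    exact (term_ord P hfz hft hbz j _ fun i => (OrdGe.of_merOrd hfz).iter_sub i.val).1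
  set F : Finset ℂ := (merOrd_finite hf r).toFinset ∪ (merOrd_finite hQ r).toFinset ∪
    Finset.univ.biUnion (fun j => (merOrd_finite (hb j) r).toFinset) with hF
  have hFf : ∀ z : ℂ, ‖z‖ ≤ r → merOrd f z ≠ 0 → z ∈ F := by
    intro z h1 h2
    simp [hF, h1, h2]
  have hFQ : ∀ z : ℂ, ‖z‖ ≤ r → merOrd (fun z => P.eval f z / f z ^ P.degU) z ≠ 0 → z ∈ F := by
    intro z h1 h2
    simp [hF, h1, h2]
  have hFb : ∀ j, ∀ z : ℂ, ‖z‖ ≤ r → merOrd (P.coeff j) z ≠ 0 → z ∈ F := by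
    intro j z h1 h2
    simp only [hF, Finset.mem_union, Finset.mem_biUnion, Set.Finite.mem_toFinset, mem_ofPred_eq]
    exact Or.inr ⟨j, Finset.mem_univ j, h1, h2⟩
  have hr0 : 0 ≤ r := by linarith
  have hbsum : ∀ j, Npoles (P.coeff j) r
      = ∑ z ∈ F, ((max (-(merOrd (P.coeff j) z)) 0 : ℤ) : ℝ) * ker1 z r := fun j =>
    intCount_eq _ hr0 F fun z hz hne => hFb j z hz fun h => hne (by simp [h])
  simp only [hbsum]
  unfold Npoles NbarPoles NzerosGe NbarZerosGe NzerosLe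
  rw [intCount_eq _ hr0 F fun z hz hne => hFQ z hz fun h => hne (by simp [h]),
    intCount_eq _ hr0 F fun z hz hne => hFf z hz fun h => hne (by simp [h]),
    intCount_eq _ hr0 F fun z hz hne => hFf z hz fun h => hne (by simp [h]),
    intCount_eq _ hr0 F fun z hz hne => hFf z hz fun h => hne (by simp [h]),
    intCount_eq _ hr0 F fun z hz hne => hFf z hz fun h => hne (by simp [h]),
    Finset.sum_comm, Finset.mul_sum, Finset.mul_sum, Finset.mul_sum, Finset.mul_sum,
    ← Finset.sum_add_distrib, ← Finset.sum_add_distrib, ← Finset.sum_add_distrib,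
    ← Finset.sum_add_distrib]
  refine Finset.sum_le_sum fun z _ => ?_
  have hk := ker1_nonneg z hr
  have hp := pointwise P (hf z (mem_univ z)) (order_ne_top hf hfnc z)
    (fun j => hb j z (mem_univ z)) ht
  have hp' := (Int.cast_le (R := ℝ)).2 hp
  rw [← Finset.sum_mul]
  refine (mul_le_mul_of_nonneg_right hp' hk).trans (le_of_eq ?_)
  simp only [Int.cast_add, Int.cast_mul, Int.cast_sub, Int.cast_natCast, Int.cast_sum]
  ring

/-- **Lemma 2.5**: for a non-constant meromorphic function `f` and a differential polynomial
`P[f]` of order `k`,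
`N(r,∞;P[f]/f^{d̄(P)}) ≤ (Γ_P - d̄(P)) N̄(r,∞;f) + (d̄(P) - d̲(P)) N(r,0;f∣≥k+1)
+ μ N̄(r,0;f∣≥k+1) + d̄(P) N(r,0;f∣≤k) + S(r,f)`. -/
theorem pole_bound_diffpoly_over_power
    (f : ℂ → ℂ) (hf : MeromorphicOn f Set.univ) (hfnc : NonConst f)
    (k t : ℕ) (ht : 0 < t)
    (P : DiffPoly k t) (hPc : P.SmallCoeffs f) :
    ∃ S : ℝ → ℝ, IsSmallWrt S f ∧ ∀ r : ℝ,
      Npoles (fun z => P.eval f z / f z ^ P.degU) r ≤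
        ((P.wt : ℝ) - (P.degU : ℝ)) * NbarPoles f r
        + ((P.degU : ℝ) - (P.degL : ℝ)) * NzerosGe ((k : ℤ) + 1) f r
        + (P.mu : ℝ) * NbarZerosGe ((k : ℤ) + 1) f r
        + (P.degU : ℝ) * NzerosLe (k : ℤ) f r + S r := by
  have hb : ∀ j, MeromorphicOn (P.coeff j) Set.univ := fun j => (hPc j).1
  set M : ℝ → ℝ := fun r => ((P.wt : ℝ) - (P.degU : ℝ)) * NbarPoles f r
        + ((P.degU : ℝ) - (P.degL : ℝ)) * NzerosGe ((k : ℤ) + 1) f r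
        + (P.mu : ℝ) * NbarZerosGe ((k : ℤ) + 1) f r
        + (P.degU : ℝ) * NzerosLe (k : ℤ) f r with hM
  set A : ℝ → ℝ := fun r => Npoles (fun z => P.eval f z / f z ^ P.degU) r with hA
  refine ⟨fun r => max (A r - M r) 0, ?_, fun r => ?_⟩
  · choose E hE hT using fun j => (hPc j).2
    refine ⟨⋃ j, E j, ?_, ?_⟩
    · refine (measure_iUnion_le _).trans_lt ?_
      rw [tsum_fintype]
      exact ENNReal.sum_lt_top.2 fun j _ => hE j
    · have hsum : Tendsto (fun r => ∑ j, nevT (P.coeff j) r / nevT f r)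
          (atTop ⊓ 𝓟 (⋃ j, E j)ᶜ) (nhds 0) := by
        have := tendsto_finsetSum (Finset.univ : Finset (Fin t))
          (f := fun j r => nevT (P.coeff j) r / nevT f r) (a := fun _ => (0:ℝ))
          (x := atTop ⊓ 𝓟 (⋃ j, E j)ᶜ) (fun j _ => (hT j).mono_left
            (inf_le_inf_left _ (principal_mono.2 (compl_subset_compl.2 (subset_iUnion E j)))))
        simpa using this
      have h1 : ∀ᶠ r : ℝ in atTop ⊓ 𝓟 (⋃ j, E j)ᶜ, 1 ≤ r :=
        (eventually_ge_atTop 1).filter_mono inf_le_left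
      have hTf : ∀ r : ℝ, 1 ≤ r → 0 ≤ nevT f r := fun r hr =>
        add_nonneg (prox_nonneg f r) (Npoles_nonneg hf hr)
      refine tendsto_of_tendsto_of_tendsto_of_le_of_le' tendsto_const_nhds hsum ?_ ?_
      · filter_upwards [h1] with r hr
        exact div_nonneg (le_max_right _ _) (hTf r hr)
      · filter_upwards [h1] with r hr
        rw [← Finset.sum_div]
        refine div_le_div_of_nonneg_right (max_le ?_ ?_) (hTf r hr)
        · have hc : A r ≤ M r + ∑ j, Npoles (P.coeff j) r :=
            counting_bound P hf hfnc hb ht hr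
          have hs : ∑ j, Npoles (P.coeff j) r ≤ ∑ j, nevT (P.coeff j) r :=
            Finset.sum_le_sum fun j _ => le_add_of_nonneg_left (prox_nonneg _ r)
          linarith
        · exact Finset.sum_nonneg fun j _ =>
            add_nonneg (prox_nonneg _ r) (Npoles_nonneg (hb j) hr)
  · change A r ≤ M r + max (A r - M r) 0
    have := le_max_left (A r - M r) 0
    linarith
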